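/- If a finite simple graph G contains a strong configuration of order k, then G contains R_{⌊k/2⌋} as an induced subgraph. Conversely, if G contains R_k as an induced subgraph, then G contains a strong configuration of order k. -/

import Mathlib

/-- `G` contains `H` as an induced subgraph. -/
def ContainsInduced {W V : Type*} (H : SimpleGraph W) (G : SimpleGraph V) : Prop :=
  ∃ f : W → V, Function.Injective f ∧
    ∀ u v : W, u ≠ v → (G.Adj (f u) (f v) ↔ H.Adj u v)

/-- The universal threshold graph `R_k`: vertices `a_1,…,a_k` (a clique) and
`b_1,…,b_k` (an independent set), with `a_i` adjacent to `b_j` iff `i ≤ j`. -/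
def Rgraph (k : ℕ) : SimpleGraph (Fin k ⊕ Fin k) :=
  SimpleGraph.fromRel (fun x y =>
    match x, y with
    | Sum.inl _, Sum.inl _ => True
    | Sum.inl i, Sum.inr j => i ≤ j
    | _, _ => False)

/-- `G` contains a strong configuration of order `k`. -/
def StrongConfig {V : Type*} (G : SimpleGraph V) (k : ℕ) : Prop :=
  ∃ a b : Fin k → V,
    Function.Injective a ∧ Function.Injective b ∧
    (∀ i j : Fin k, a i ≠ b j) ∧
    (∀ i j : Fin k, i ≠ j → G.Adj (a i) (a j)) ∧
    (∀ i j : Fin k, ¬ G.Adj (b i) (b j)) ∧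
    (∀ i j : Fin k, i < j → G.Adj (a i) (b j) ∧ ¬ G.Adj (b i) (a j))

@[simp] lemma Rgraph_adj_inl_inl {k : ℕ} (i j : Fin k) :
    (Rgraph k).Adj (Sum.inl i) (Sum.inl j) ↔ i ≠ j := by
  simp [Rgraph]

@[simp] lemma Rgraph_adj_inl_inr {k : ℕ} (i j : Fin k) :
    (Rgraph k).Adj (Sum.inl i) (Sum.inr j) ↔ i ≤ j := by
  simp [Rgraph]

@[simp] lemma Rgraph_adj_inr_inl {k : ℕ} (i j : Fin k) :
    (Rgraph k).Adj (Sum.inr i) (Sum.inl j) ↔ j ≤ i := by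
  simp [Rgraph]

@[simp] lemma Rgraph_adj_inr_inr {k : ℕ} (i j : Fin k) :
    ¬ (Rgraph k).Adj (Sum.inr i) (Sum.inr j) := by
  simp [Rgraph]

/-- The clique vertices with even index and the independent vertices with odd index of a strong
configuration induce a universal threshold graph. -/
lemma StrongConfig.containsInduced_Rgraph {V : Type*} {G : SimpleGraph V} {k : ℕ}
    (h : StrongConfig G k) : ContainsInduced (Rgraph (k / 2)) G := by
  obtain ⟨a, b, ha, hb, hab, hclique, hindep, hcross⟩ := h
  let even (i : Fin (k / 2)) : Fin k := ⟨2 * i, by omega⟩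
  let odd (i : Fin (k / 2)) : Fin k := ⟨2 * i + 1, by omega⟩
  have even_inj : Function.Injective even := fun i j hij => by
    have := congrArg Fin.val hij
    simp only [even] at this
    omega
  have odd_inj : Function.Injective odd := fun i j hij => by
    have := congrArg Fin.val hij
    simp only [odd] at this
    omega
  have adj_iff (i j : Fin (k / 2)) : G.Adj (a (even i)) (b (odd j)) ↔ i ≤ j := by
    rcases le_or_gt i j with hij | hij
    · exact iff_of_true (hcross _ _ (by simp only [even, odd, Fin.lt_def]; omega)).1 hij
    · refine iff_of_false (fun hadj => ?_) hij.not_ge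
      exact (hcross (odd j) (even i) (by simp only [even, odd, Fin.lt_def]; omega)).2 hadj.symm
  refine ⟨Sum.elim (a ∘ even) (b ∘ odd),
    (ha.comp even_inj).sumElim (hb.comp odd_inj) fun i j => hab _ _, ?_⟩
  rintro (i | i) (j | j) hij
  · have hne : i ≠ j := fun h => hij (congrArg _ h)
    simpa [hne] using hclique _ _ (even_inj.ne hne)
  · simpa using adj_iff i j
  · simpa [G.adj_comm] using adj_iff j i
  · simpa using hindep _ _

lemma ContainsInduced.strongConfig {V : Type*} {G : SimpleGraph V} {k : ℕ}
    (h : ContainsInduced (Rgraph k) G) : StrongConfig G k := by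
  obtain ⟨f, hf, hadj⟩ := h
  refine ⟨f ∘ Sum.inl, f ∘ Sum.inr, hf.comp Sum.inl_injective, hf.comp Sum.inr_injective,
    fun i j => hf.ne Sum.inl_ne_inr, fun i j hij => ?_, fun i j => ?_, fun i j hij => ⟨?_, ?_⟩⟩
  · exact (hadj _ _ (Sum.inl_injective.ne hij)).2 (by simpa using hij)
  · rcases eq_or_ne i j with rfl | hij
    · exact G.irrefl
    · simp [hadj _ _ (Sum.inr_injective.ne hij)]
  · exact (hadj _ _ Sum.inl_ne_inr).2 (by simpa using hij.le)
  · simp [hadj _ _ Sum.inr_ne_inl, hij]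

theorem stmt8 (V : Type) [Fintype V] (G : SimpleGraph V) (k : ℕ) :
    (StrongConfig G k → ContainsInduced (Rgraph (k / 2)) G) ∧
    (ContainsInduced (Rgraph k) G → StrongConfig G k) :=
  ⟨StrongConfig.containsInduced_Rgraph, ContainsInduced.strongConfig⟩
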